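/- arXiv:2602.05124 — 2 statements merged into one kernel-verified Lean document; each statement's English description precedes it below -/
import Mathlib

section
/- (Fixed-point convergence, main theorem.) Let H : ℝ^n → ℝ be strictly convex and continuously differentiable with ∇H Lipschitz with constant L_H and ∇H : ℝ^n → ℝ^n a bijection, and let g : ℝ^n → ℝ be convex and continuously differentiable with ∇g Lipschitz with constant L_g. Fix x ∈ ℝ^n and t > 0 with t·L_H·L_g < 1. Let y* be the unique fixed point of F(y) = x − t·∇H(∇g(y)) (to which the Picard iteration converges from any initial point). Then y* is the unique global minimizer over ℝ^n of the Hopf–Lax functional φ(y) = t·H*((x−y)/t) + g(y), where H*(q) = sup_{p ∈ ℝ^n} (⟨q,p⟩ − H(p)). -/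
open scoped RealInnerProductSpace

section

variable {E : Type*} [NormedAddCommGroup E] [InnerProductSpace ℝ E] [CompleteSpace E]

/-- A convex function lies above its tangent hyperplane at any point of differentiability. -/
theorem ConvexOn.add_inner_gradient_le {f : E → ℝ} (hf : ConvexOn ℝ Set.univ f) {a : E}
    (ha : DifferentiableAt ℝ f a) (b : E) : f a + ⟪gradient f a, b - a⟫ ≤ f b := by
  have hline : ConvexOn ℝ Set.univ (f ∘ AffineMap.lineMap (k := ℝ) a b) := by
    simpa using hf.comp_affineMap (AffineMap.lineMap (k := ℝ) a b)
  have hderiv : HasDerivAt (f ∘ AffineMap.lineMap (k := ℝ) a b) (fderiv ℝ f a (b - a)) 0 := by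
    refine HasFDerivAt.comp_hasDerivAt (0 : ℝ) ?_ AffineMap.hasDerivAt_lineMap
    simpa using ha.hasFDerivAt
  have hslope := hline.le_slope_of_hasDerivAt (Set.mem_univ _) (Set.mem_univ _) one_pos hderiv
  simp only [slope_def_field, Function.comp_apply, AffineMap.lineMap_apply_one,
    AffineMap.lineMap_apply_zero, sub_zero, div_one] at hslope
  rw [inner_gradient_left]
  linarith

/-- At a maximizer of `p ↦ ⟪q, p⟫ - H p` the gradient of `H` is `q`. -/
theorem gradient_eq_of_forall_inner_sub_le {H : E → ℝ} {p q : E} (hH : DifferentiableAt ℝ H p)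
    (hmax : ∀ r, ⟪q, r⟫ - H r ≤ ⟪q, p⟫ - H p) : gradient H p = q := by
  have hloc : IsLocalMax (fun r => ⟪q, r⟫ - H r) p := Filter.Eventually.of_forall hmax
  have hzero := hloc.hasFDerivAt_eq_zero ((innerSL ℝ q).hasFDerivAt.sub hH.hasFDerivAt)
  refine ext_inner_right ℝ fun v => ?_
  have hv := DFunLike.congr_fun hzero v
  simp only [sub_apply, innerSL_apply_apply, zero_apply] at hv
  rw [inner_gradient_left]
  linarith

/-- Fenchel's equality at `q = ∇H(p)`, where `c` is the value of the conjugate of `H` at `q`. -/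
theorem ConvexOn.eq_inner_sub_of_isLUB {H : E → ℝ} (hconv : ConvexOn ℝ Set.univ H) {p : E}
    (hH : DifferentiableAt ℝ H p) {c : ℝ}
    (hc : IsLUB (Set.range fun r => ⟪gradient H p, r⟫ - H r) c) :
    c = ⟪gradient H p, p⟫ - H p := by
  refine le_antisymm (hc.2 ?_) (hc.1 ⟨p, rfl⟩)
  rintro _ ⟨r, rfl⟩
  have h := hconv.add_inner_gradient_le hH r
  rw [inner_sub_right] at h
  dsimp only
  linarith

/-- Fenchel's inequality is strict unless `q = ∇H(p)`. -/
theorem inner_sub_lt_of_isLUB {H : E → ℝ} {p q : E} (hH : DifferentiableAt ℝ H p)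
    (hq : gradient H p ≠ q) {c : ℝ} (hc : IsLUB (Set.range fun r => ⟪q, r⟫ - H r) c) :
    ⟪q, p⟫ - H p < c := by
  refine lt_of_le_of_ne (hc.1 ⟨p, rfl⟩) fun heq => hq ?_
  exact gradient_eq_of_forall_inner_sub_le hH fun r => heq ▸ hc.1 ⟨r, rfl⟩

end

/-- Fixed-point convergence, main theorem: under strict convexity of `H`,
convexity of `g`, Lipschitz gradients, bijectivity of `∇H`, and `t·L_H·L_g < 1`, the unique
fixed point `y*` of `F(y) = x − t·∇H(∇g(y))` is the unique global minimizer of the Hopf–Lax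
functional `φ(y) = t·H*((x−y)/t) + g(y)`. -/
theorem hopf_lax_fixed_point_is_unique_minimizer {n : ℕ}
    (H g : EuclideanSpace ℝ (Fin n) → ℝ)
    (hHconv : StrictConvexOn ℝ Set.univ H) (hH : ContDiff ℝ 1 H)
    (hbij : Function.Bijective (gradient H))
    (hgconv : ConvexOn ℝ Set.univ g) (hg : ContDiff ℝ 1 g)
    (L_H L_g : ℝ) (hLH0 : 0 ≤ L_H) (hLg0 : 0 ≤ L_g)
    (hLH : ∀ p₁ p₂, ‖gradient H p₁ - gradient H p₂‖ ≤ L_H * ‖p₁ - p₂‖)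
    (hLg : ∀ y₁ y₂, ‖gradient g y₁ - gradient g y₂‖ ≤ L_g * ‖y₁ - y₂‖)
    (x : EuclideanSpace ℝ (Fin n)) (t : ℝ) (ht : 0 < t)
    (hcontr : t * L_H * L_g < 1)
    (Hstar : EuclideanSpace ℝ (Fin n) → ℝ)
    (hHstar : ∀ q, IsLUB (Set.range fun p => ⟪q, p⟫ - H p) (Hstar q))
    (ystar : EuclideanSpace ℝ (Fin n))
    (hfix : ystar = x - t • gradient H (gradient g ystar)) :
    ∀ y, y ≠ ystar →
      t * Hstar (t⁻¹ • (x - ystar)) + g ystar < t * Hstar (t⁻¹ • (x - y)) + g y := by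
  intro y hy
  set p := gradient g ystar with hp
  have hHd : DifferentiableAt ℝ H p := (hH.differentiable one_ne_zero).differentiableAt
  have hgd : DifferentiableAt ℝ g ystar := (hg.differentiable one_ne_zero).differentiableAt
  have hqstar : t⁻¹ • (x - ystar) = gradient H p := by
    rw [inv_smul_eq_iff₀ ht.ne', sub_eq_iff_eq_add]
    exact (eq_sub_iff_add_eq'.mp hfix).symm
  have hq : gradient H p ≠ t⁻¹ • (x - y) := by
    rw [← hqstar]
    intro h
    exact hy (sub_right_injective (smul_right_injective _ (inv_ne_zero ht.ne') h)).symm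
  have hstar : Hstar (t⁻¹ • (x - ystar)) = ⟪t⁻¹ • (x - ystar), p⟫ - H p := by
    rw [hqstar]
    exact hHconv.convexOn.eq_inner_sub_of_isLUB hHd (hHstar _)
  have hlt := mul_lt_mul_of_pos_left (inner_sub_lt_of_isLUB hHd hq (hHstar _)) ht
  have htangent := hgconv.add_inner_gradient_le hgd y
  rw [← hp, real_inner_comm] at htangent
  rw [hstar]
  simp only [real_inner_smul_left, inner_sub_left, mul_sub, mul_inv_cancel_left₀ ht.ne']
    at hlt htangent ⊢
  linarith
end

section
/- (Gradient of the value function at the fixed point.) Let H : ℝ^n → ℝ be strictly convex and continuously differentiable with ∇H Lipschitz with constant L_H and ∇H a bijection of ℝ^n, and let g : ℝ^n → ℝ be convex and continuously differentiable with ∇g Lipschitz with constant L_g. Fix t > 0 with t·L_H·L_g < 1 and define u(x,t) = inf_{y ∈ ℝ^n} { t·H*((x−y)/t) + g(y) }, where H*(q) = sup_p (⟨q,p⟩ − H(p)). Then for every x ∈ ℝ^n, letting y*(x) be the unique fixed point of y ↦ x − t·∇H(∇g(y)), the function x ↦ u(x,t) is differentiable at x with gradient ∇_x u(x,t) = ∇H*((x−y*(x))/t)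 = ∇g(y*(x)). -/
open scoped RealInnerProductSpace Topology

section Convex

variable {E : Type*} [NormedAddCommGroup E] [InnerProductSpace ℝ E] [CompleteSpace E]
  {f : E → ℝ} {v x : E}

/-- The first-order characterization of convexity. -/
lemma ConvexOn.add_inner_le (hf : ConvexOn ℝ Set.univ f) (hv : HasGradientAt f v x) (y : E) :
    f x + ⟪v, y - x⟫ ≤ f y := by
  have hc : ConvexOn ℝ Set.univ (f ∘ AffineMap.lineMap (k := ℝ) x y) := by
    simpa using hf.comp_affineMap (AffineMap.lineMap (k := ℝ) x y)
  have hd : HasDerivAt (f ∘ AffineMap.lineMap (k := ℝ) x y) ⟪v, y - x⟫ 0 := by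
    have hv' : HasFDerivAt f (InnerProductSpace.toDual ℝ E v)
        (AffineMap.lineMap (k := ℝ) x y 0) := by
      simpa using hv.hasFDerivAt
    simpa using hv'.comp_hasDerivAt (0 : ℝ) AffineMap.hasDerivAt_lineMap
  have h := hc.le_slope_of_hasDerivAt (Set.mem_univ 0) (Set.mem_univ 1) zero_lt_one hd
  simp only [slope_def_field, Function.comp_apply, AffineMap.lineMap_apply_zero,
    AffineMap.lineMap_apply_one] at h
  linarith

lemma StrictConvexOn.add_inner_lt (hf : StrictConvexOn ℝ Set.univ f) (hv : HasGradientAt f v x)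
    {y : E} (hy : y ≠ x) : f x + ⟪v, y - x⟫ < f y := by
  have h₁ := hf.2 (Set.mem_univ x) (Set.mem_univ y) hy.symm
    (show (0 : ℝ) < 1 / 2 by norm_num) (show (0 : ℝ) < 1 / 2 by norm_num) (by norm_num)
  have h₂ := hf.convexOn.add_inner_le hv ((1 / 2 : ℝ) • x + (1 / 2 : ℝ) • y)
  have h₃ : (1 / 2 : ℝ) • x + (1 / 2 : ℝ) • y - x = (1 / 2 : ℝ) • (y - x) := by module
  rw [h₃, real_inner_smul_right] at h₂
  simp only [smul_eq_mul] at h₁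
  linarith

/-- A strictly convex function grows at least linearly above its tangent plane. -/
lemma StrictConvexOn.exists_mul_norm_sub_le [FiniteDimensional ℝ E]
    (hf : StrictConvexOn ℝ Set.univ f) (hcont : Continuous f) (hv : HasGradientAt f v x)
    {ε : ℝ} (hε : 0 < ε) :
    ∃ c > 0, ∀ y, ε ≤ ‖y - x‖ → f x + ⟪v, y - x⟫ + c * ‖y - x‖ ≤ f y := by
  obtain ⟨m, hm, hmin⟩ : ∃ m > 0, ∀ z ∈ Metric.sphere x ε, m ≤ f z - f x - ⟪v, z - x⟫ := by
    rcases (Metric.sphere x ε).eq_empty_or_nonempty with h | h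
    · exact ⟨1, one_pos, by simp [h]⟩
    · obtain ⟨z, hz, hzmin⟩ := (isCompact_sphere x ε).exists_isMinOn h
        (f := fun z => f z - f x - ⟪v, z - x⟫) (by fun_prop)
      have hzx : z ≠ x := by
        rintro rfl
        simp [hε.ne] at hz
      exact ⟨_, by linarith [hf.add_inner_lt hv hzx], fun w hw => hzmin hw⟩
  refine ⟨m / ε, div_pos hm hε, fun y hy => ?_⟩
  have hr : 0 < ‖y - x‖ := hε.trans_le hy
  set s := ε / ‖y - x‖ with hs
  have hs₀ : 0 < s := div_pos hε hr
  have hs₁ : s ≤ 1 := (div_le_one hr).2 hy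
  have hsub : (1 - s) • x + s • y - x = s • (y - x) := by module
  have h₁ := hmin ((1 - s) • x + s • y) (by
    rw [mem_sphere_iff_norm, hsub, norm_smul, Real.norm_of_nonneg hs₀.le, hs,
      div_mul_cancel₀ _ hr.ne'])
  have h₂ := hf.convexOn.2 (Set.mem_univ x) (Set.mem_univ y) (sub_nonneg.2 hs₁) hs₀.le
    (sub_add_cancel 1 s)
  rw [hsub, real_inner_smul_right] at h₁
  simp only [smul_eq_mul] at h₂
  have h₃ : m = s * (m / ε * ‖y - x‖) := by
    rw [hs]
    field_simp
  have h₄ : 0 ≤ s * (f y - (f x + ⟪v, y - x⟫ + m / ε * ‖y - x‖)) := by linarith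
  linarith [nonneg_of_mul_nonneg_right h₄ hs₀]

/-- The Fenchel equality at a point where the function has a gradient. -/
lemma ConvexOn.conjugate_eq (hf : ConvexOn ℝ Set.univ f) (hv : HasGradientAt f v x) {fs : E → ℝ}
    (hfs : ∀ q, IsLUB (Set.range fun p => ⟪q, p⟫ - f p) (fs q)) : fs v = ⟪v, x⟫ - f x := by
  refine le_antisymm ((hfs v).2 ?_) ((hfs v).1 ⟨x, rfl⟩)
  rintro _ ⟨p, rfl⟩
  have h := hf.add_inner_le hv p
  rw [inner_sub_right] at h
  dsimp only
  linarith

/-- The conjugate lies above the affine function of slope `x` touching it at `v = ∇ f x`. -/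
lemma ConvexOn.conjugate_add_inner_le (hf : ConvexOn ℝ Set.univ f) (hv : HasGradientAt f v x)
    {fs : E → ℝ} (hfs : ∀ q, IsLUB (Set.range fun p => ⟪q, p⟫ - f p) (fs q)) (q : E) :
    fs v + ⟪x, q - v⟫ ≤ fs q := by
  have h := (hfs q).1 ⟨x, rfl⟩
  dsimp only at h
  rw [hf.conjugate_eq hv hfs, inner_sub_right, real_inner_comm q x, real_inner_comm v x]
  linarith

/-- The Fenchel conjugate of a strictly convex function is differentiable at `∇ f x`, with
gradient `x`. -/
lemma StrictConvexOn.hasGradientAt_conjugate [FiniteDimensional ℝ E]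
    (hf : StrictConvexOn ℝ Set.univ f) (hcont : Continuous f) (hv : HasGradientAt f v x)
    {fs : E → ℝ} (hfs : ∀ q, IsLUB (Set.range fun p => ⟪q, p⟫ - f p) (fs q)) :
    HasGradientAt fs x v := by
  rw [hasGradientAt_iff_isLittleO, Asymptotics.isLittleO_iff]
  intro ε hε
  obtain ⟨c, hc, hgrow⟩ := hf.exists_mul_norm_sub_le hcont hv hε
  filter_upwards [Metric.ball_mem_nhds v hc] with q hq
  rw [mem_ball_iff_norm] at hq
  have hlow := hf.convexOn.conjugate_add_inner_le hv hfs q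
  rw [Real.norm_of_nonneg (by linarith)]
  suffices h : fs q ≤ fs v + ⟪x, q - v⟫ + ε * ‖q - v‖ by linarith
  refine (hfs q).2 ?_
  rintro _ ⟨p, rfl⟩
  have hsplit : ⟪q, p⟫ = ⟪v, x⟫ + ⟪x, q - v⟫ + ⟪v, p - x⟫ + ⟪q - v, p - x⟫ := by
    simp only [inner_sub_left, inner_sub_right, real_inner_comm q x, real_inner_comm v x]
    ring
  have hcs := real_inner_le_norm (q - v) (p - x)
  have hfv := hf.convexOn.conjugate_eq hv hfs
  dsimp only
  rcases le_total ε ‖p - x‖ with h | h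
  · have h₁ := hgrow p h
    have h₂ := mul_le_mul_of_nonneg_right hq.le (norm_nonneg (p - x))
    have h₃ : 0 ≤ ε * ‖q - v‖ := by positivity
    linarith
  · have h₁ := hf.convexOn.add_inner_le hv p
    have h₂ := mul_le_mul_of_nonneg_left h (norm_nonneg (q - v))
    linarith

end Convex

/-- Gradient of the value function at the fixed point: with `H` strictly
convex, `∇H` bijective and `L_H`-Lipschitz, `g` convex with `L_g`-Lipschitz gradient,
`t·L_H·L_g < 1`, `H*` the Fenchel conjugate, and `u(·,t)` the Hopf–Lax value function, for
every `x` the map `x ↦ u(x,t)` is differentiable at `x` with gradient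
`∇H*((x − y*(x))/t) = ∇g(y*(x))`, where `y*(x)` is the unique fixed point of
`y ↦ x − t·∇H(∇g(y))`. -/
theorem hopf_lax_value_function_gradient {n : ℕ}
    (H g : EuclideanSpace ℝ (Fin n) → ℝ)
    (hHconv : StrictConvexOn ℝ Set.univ H) (hH : ContDiff ℝ 1 H)
    (hbij : Function.Bijective (gradient H))
    (hgconv : ConvexOn ℝ Set.univ g) (hg : ContDiff ℝ 1 g)
    (L_H L_g : ℝ) (hLH0 : 0 ≤ L_H) (hLg0 : 0 ≤ L_g)
    (hLH : ∀ p₁ p₂, ‖gradient H p₁ - gradient H p₂‖ ≤ L_H * ‖p₁ - p₂‖)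
    (hLg : ∀ y₁ y₂, ‖gradient g y₁ - gradient g y₂‖ ≤ L_g * ‖y₁ - y₂‖)
    (t : ℝ) (ht : 0 < t) (hcontr : t * L_H * L_g < 1)
    (Hstar : EuclideanSpace ℝ (Fin n) → ℝ)
    (hHstar : ∀ q, IsLUB (Set.range fun p => ⟪q, p⟫ - H p) (Hstar q))
    (u : EuclideanSpace ℝ (Fin n) → ℝ)
    (hu : ∀ x, IsGLB (Set.range fun y => t * Hstar (t⁻¹ • (x - y)) + g y) (u x))
    (ystar : EuclideanSpace ℝ (Fin n) → EuclideanSpace ℝ (Fin n))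
    (hystar : ∀ x, ystar x = x - t • gradient H (gradient g (ystar x)))
    (hystar_unique : ∀ x z, z = x - t • gradient H (gradient g z) → z = ystar x) :
    ∀ x, HasGradientAt u (gradient g (ystar x)) x ∧
      HasGradientAt Hstar (gradient g (ystar x)) (t⁻¹ • (x - ystar x)) := by
  intro x
  have hp : HasGradientAt H (gradient H (gradient g (ystar x))) (gradient g (ystar x)) :=
    (hH.differentiable one_ne_zero _).hasGradientAt
  have hgrad : HasGradientAt g (gradient g (ystar x)) (ystar x) :=
    (hg.differentiable one_ne_zero _).hasGradientAt
  have hy := hystar x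
  set y := ystar x
  set p := gradient g y
  have hq : t⁻¹ • (x - y) = gradient H p := by
    rw [inv_smul_eq_iff₀ ht.ne', sub_eq_iff_eq_add', ← sub_eq_iff_eq_add]
    exact hy.symm
  rw [← hq] at hp
  refine ⟨?_, hHconv.hasGradientAt_conjugate hH.continuous hp hHstar⟩
  have hlow : ∀ z, t * Hstar (t⁻¹ • (x - y)) + g y + ⟪p, z - x⟫ ≤ u z := by
    refine fun z => (hu z).2 ?_
    rintro _ ⟨w, rfl⟩
    have h₁ := hHconv.convexOn.conjugate_add_inner_le hp hHstar (t⁻¹ • (z - w))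
    have h₂ := hgconv.add_inner_le hgrad w
    have h₃ : t⁻¹ • (z - w) - t⁻¹ • (x - y) = t⁻¹ • ((z - x) - (w - y)) := by module
    rw [h₃, real_inner_smul_right, inner_sub_right] at h₁
    have h₄ := mul_le_mul_of_nonneg_left h₁ ht.le
    rw [mul_add, mul_inv_cancel_left₀ ht.ne'] at h₄
    dsimp only
    linarith
  have hup : ∀ z, u z ≤ t * Hstar (t⁻¹ • (x - y)) + g (y + (z - x)) := by
    intro z
    have h := (hu z).1 ⟨y + (z - x), rfl⟩
    have hz : z - (y + (z - x)) = x - y := by abel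
    simpa only [hz] using h
  have hux : u x = t * Hstar (t⁻¹ • (x - y)) + g y :=
    le_antisymm (by simpa using hup x) (by simpa using hlow x)
  rw [hasGradientAt_iff_isLittleO_nhds_zero] at hgrad ⊢
  refine Asymptotics.IsBigO.trans_isLittleO (Asymptotics.IsBigO.of_norm_le fun h => ?_) hgrad
  have h₁ := hlow (x + h)
  have h₂ := hup (x + h)
  rw [add_sub_cancel_left] at h₁ h₂
  rw [Real.norm_of_nonneg (by linarith)]
  linarith
end
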